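/- arXiv:2212.02214 — 7 statements merged into one kernel-verified Lean document; each statement's English description precedes it below -/
import Mathlib

section
/- Let z₊ > 0 > z₋ be real numbers. Then for every real u ≠ 0, the differential capacitance C(u) = sgn(u)·z₊ z₋ (e^{−z₊ u} − e^{−z₋ u}) / (√2 · √(R(u))) is strictly positive. -/
open Real

/-- The radicand `R(u) = −z₋ e^{−z₊ u} + z₊ e^{−z₋ u} + z₋ − z₊`. -/
noncomputable def radicand (zp zm u : ℝ) : ℝ :=
  -zm * exp (-zp * u) + zp * exp (-zm * u) + zm - zp

/-- The differential capacitance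
`C(u) = sgn(u)·z₊ z₋ (e^{−z₊ u} − e^{−z₋ u}) / (√2 · √(R(u)))`. -/
noncomputable def diffCap (zp zm u : ℝ) : ℝ :=
  Real.sign u * (zp * zm * (exp (-zp * u) - exp (-zm * u))) /
    (Real.sqrt 2 * Real.sqrt (radicand zp zm u))

/-- For `z₊ > 0 > z₋` and every `u ≠ 0`, the differential capacitance `C(u)` is
strictly positive. -/
theorem diffCap_pos (zp zm : ℝ) (hzp : 0 < zp) (hzm : zm < 0) (u : ℝ) (hu : u ≠ 0) :
    0 < diffCap zp zm u := by
  have hR : 0 < radicand zp zm u := by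
    unfold radicand
    have h1 := Real.add_one_lt_exp (mul_ne_zero (neg_ne_zero.mpr hzp.ne') hu)
    have h2 := Real.add_one_lt_exp (mul_ne_zero (neg_ne_zero.mpr hzm.ne) hu)
    have h3 := mul_lt_mul_of_pos_left h1 (neg_pos.mpr hzm)
    have h4 := mul_lt_mul_of_pos_left h2 hzp
    nlinarith
  have hz : zp * zm < 0 := mul_neg_of_pos_of_neg hzp hzm
  unfold diffCap
  apply div_pos
  · rcases lt_or_gt_of_ne hu with h | h
    · rw [Real.sign_of_neg h]
      have h5 : exp (-zm * u) < exp (-zp * u) := by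
        apply Real.exp_lt_exp.mpr
        nlinarith
      have := mul_neg_of_neg_of_pos hz (sub_pos.mpr h5)
      linarith
    · rw [Real.sign_of_pos h]
      have h5 : exp (-zp * u) < exp (-zm * u) := by
        apply Real.exp_lt_exp.mpr
        nlinarith
      have := mul_pos_of_neg_of_neg hz (sub_neg.mpr h5)
      linarith
  · exact mul_pos (Real.sqrt_pos.mpr two_pos) (Real.sqrt_pos.mpr hR)
end

section
/- Let z₊ > 0 > z₋ be real numbers and set α = z₋² z₊ − z₊² z₋. Then α > 0, and the differential capacitance C(u) tends to √α as u tends to 0 with u ≠ 0 (so C extends continuously to u = 0 with value √α = √(z₋² z₊ − z₊² z₋)). -/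
open Real Filter

/-- For `z₊ > 0 > z₋`, the constant `α = z₋² z₊ − z₊² z₋` is positive and
the differential capacitance `C(u)` tends to `√α` as `u → 0`, `u ≠ 0`;
i.e. `C` extends continuously to `0` with value `√(z₋² z₊ − z₊² z₋)`. -/
theorem diffCap_tendsto_sqrt_alpha (zp zm : ℝ) (hzp : 0 < zp) (hzm : zm < 0) :
    0 < zm ^ 2 * zp - zp ^ 2 * zm ∧
    Tendsto (fun u => diffCap zp zm u) (nhdsWithin 0 {(0 : ℝ)}ᶜ)
      (nhds (Real.sqrt (zm ^ 2 * zp - zp ^ 2 * zm))) := by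
  have hα : 0 < zm ^ 2 * zp - zp ^ 2 * zm := by
    have h1 : 0 < zm ^ 2 * zp := mul_pos (sq_pos_of_neg hzm) hzp
    have h2 : zp ^ 2 * zm < 0 := mul_neg_of_pos_of_neg (by positivity) hzm
    linarith
  refine ⟨hα, ?_⟩
  set α := zm ^ 2 * zp - zp ^ 2 * zm with hαdef
  have hexp : ∀ z u : ℝ, HasDerivAt (fun u => exp (-z * u)) (exp (-z * u) * (-z)) u := by
    intro z u
    simpa using ((hasDerivAt_id u).const_mul (-z)).exp
  have hN : Tendsto (fun u => zp * zm * (exp (-zp * u) - exp (-zm * u)) / u)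
      (nhdsWithin 0 {(0 : ℝ)}ᶜ) (nhds α) := by
    have h := (((hexp zp 0).sub (hexp zm 0)).const_mul (zp * zm)).tendsto_slope
    have e : zp * zm * (exp (-zp * 0) * (-zp) - exp (-zm * 0) * (-zm)) = α := by
      simp [hαdef]; ring
    rw [e] at h
    refine h.congr fun u => ?_
    simp [slope_def_field]
  have hR : Tendsto (fun u => radicand zp zm u / u ^ 2)
      (nhdsWithin 0 {(0 : ℝ)}ᶜ) (nhds (α / 2)) := by
    have hRd : ∀ u, HasDerivAt (radicand zp zm)
        (zp * zm * (exp (-zp * u) - exp (-zm * u))) u := by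
      intro u
      have h := ((((hexp zp u).const_mul (-zm)).add ((hexp zm u).const_mul zp)).add_const
        zm).sub_const zp
      exact h.congr_deriv (by ring)
    have hsq : ∀ u : ℝ, HasDerivAt (fun u : ℝ => u ^ 2) (2 * u) u := by
      intro u
      simpa using hasDerivAt_pow 2 u
    refine HasDerivAt.lhopital_zero_nhdsNE (Eventually.of_forall hRd)
      (Eventually.of_forall hsq) ?_ ?_ ?_ ?_
    · filter_upwards [self_mem_nhdsWithin] with u hu
      simpa using hu
    · have h := (hRd 0).continuousAt.tendsto
      have e : radicand zp zm 0 = 0 := by simp [radicand]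
      rw [e] at h
      exact h.mono_left nhdsWithin_le_nhds
    · have h := (hsq 0).continuousAt.tendsto
      simp only [ne_eq, OfNat.ofNat_ne_zero, not_false_eq_true, zero_pow] at h
      exact h.mono_left nhdsWithin_le_nhds
    · refine (hN.div_const 2).congr fun u => ?_
      rw [div_div, mul_comm u 2]
  have hs : Real.sqrt 2 * Real.sqrt (α / 2) = Real.sqrt α := by
    rw [← Real.sqrt_mul (by norm_num)]
    congr 1
    ring
  have hmain := hN.div (hR.sqrt.const_mul (Real.sqrt 2))
    (by rw [hs]; exact (Real.sqrt_pos.2 hα).ne')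
  rw [hs, Real.div_sqrt] at hmain
  refine hmain.congr' ?_
  filter_upwards [self_mem_nhdsWithin] with u hu
  have hu0 : u ≠ 0 := hu
  simp only [Pi.div_apply, diffCap]
  rw [Real.sqrt_div' _ (sq_nonneg u), Real.sqrt_sq_eq_abs]
  rcases lt_or_gt_of_ne hu0 with h | h
  · rw [Real.sign_of_neg h, abs_of_neg h]
    field_simp
  · rw [Real.sign_of_pos h, abs_of_pos h]
    field_simp
end

section
/- Let z > 0 and consider the symmetric binary electrolyte with z₊ = z and z₋ = −z. Then for every real u ≠ 0, the differential capacitance satisfies C(u) = √2 · z^{3/2} · cosh(z u / 2). -/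
open Real

/-- For a symmetric binary electrolyte with `z₊ = z` and `z₋ = −z`, `z > 0`,
the differential capacitance is `C(u) = √2 · z^{3/2} · cosh(z u / 2)` for every `u ≠ 0`. -/
theorem diffCap_symmetric (z : ℝ) (hz : 0 < z) :
    ∀ u : ℝ, u ≠ 0 →
      diffCap z (-z) u = Real.sqrt 2 * z ^ ((3 : ℝ) / 2) * Real.cosh (z * u / 2) := by
  intro u hu
  have ha : 0 < exp (z * u / 2) := exp_pos _
  have hb : 0 < exp (-(z * u / 2)) := exp_pos _
  have hab : exp (z * u / 2) * exp (-(z * u / 2)) = 1 := by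
    rw [← Real.exp_add]; simp
  have e1 : exp (-z * u) = exp (-(z * u / 2)) ^ 2 := by
    rw [← Real.exp_nat_mul]; congr 1; push_cast; ring
  have e2 : exp (- -z * u) = exp (z * u / 2) ^ 2 := by
    rw [← Real.exp_nat_mul]; congr 1; push_cast; ring
  have hpow : z ^ ((3 : ℝ) / 2) = z * sqrt z := by
    rw [show (3 : ℝ) / 2 = 1 + 1 / 2 by norm_num, Real.rpow_add hz, Real.rpow_one,
      Real.sqrt_eq_rpow]
  have hlt : 0 < u → exp (-(z * u / 2)) < exp (z * u / 2) := fun h => by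
    have := mul_pos hz h
    exact Real.exp_lt_exp.mpr (by linarith)
  have hgt : u < 0 → exp (z * u / 2) < exp (-(z * u / 2)) := fun h => by
    have := mul_neg_of_pos_of_neg hz h
    exact Real.exp_lt_exp.mpr (by linarith)
  unfold diffCap radicand
  rw [e1, e2, hpow, Real.cosh_eq]
  generalize exp (z * u / 2) = a at *
  generalize exp (-(z * u / 2)) = b at *
  have hR : - -z * b ^ 2 + z * a ^ 2 + -z - z = z * (a - b) ^ 2 := by
    linear_combination 2 * z * hab
  rw [hR, Real.sqrt_mul hz.le, Real.sqrt_sq_eq_abs]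
  have hs : sqrt z * sqrt z = z := Real.mul_self_sqrt hz.le
  have h2 : sqrt 2 * sqrt 2 = (2 : ℝ) := Real.mul_self_sqrt (by norm_num)
  have hsp : 0 < sqrt z := Real.sqrt_pos.mpr hz
  have h2p : (0 : ℝ) < sqrt 2 := Real.sqrt_pos.mpr (by norm_num)
  generalize sqrt z = s at *
  generalize sqrt (2 : ℝ) = t at *
  rcases lt_or_gt_of_ne hu with h | h
  · have hd : 0 < b - a := sub_pos.mpr (hgt h)
    rw [Real.sign_of_neg h, abs_of_neg (by linarith), div_eq_iff (by
      rw [neg_sub]; positivity)]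
    linear_combination (-(z * (b - a) * (a + b) / 2)) * (s * s * h2 + 2 * hs)
  · have hd : 0 < a - b := sub_pos.mpr (hlt h)
    rw [Real.sign_of_pos h, abs_of_pos hd, div_eq_iff (by positivity)]
    linear_combination (-(z * (a - b) * (a + b) / 2)) * (s * s * h2 + 2 * hs)
end

section
/- Given an integer n ≥ 2 and positive reals h and L, let T be the matrix described in the context. Then for x ∈ ℝ^{2n}, T x = 0 if and only if x is a constant vector (all entries of x are equal). In particular, the kernel of T is the one-dimensional span of the all-ones vector. -/
open Matrix

/-- The `2n × 2n` coupling matrix `T` of the generalized equivalent circuit ODE system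
for a stack-electrode supercapacitor with `2n` stacks (indices here are `0`-based; the
paper's index `k` corresponds to `i = k − 1`). -/
noncomputable def stackT (n : ℕ) (h L : ℝ) : Matrix (Fin (2 * n)) (Fin (2 * n)) ℝ :=
  Matrix.of fun i j =>
    if i.val = j.val then
      if i.val = 0 ∨ i.val = 2 * n - 1 then 1 / h
      else if i.val = n - 1 ∨ i.val = n then 1 / h + 1 / (2 * L)
      else 2 / h
    else if i.val + 1 = j.val ∨ j.val + 1 = i.val then
      if min i.val j.val = n - 1 then -(1 / (2 * L)) else -(1 / h)
    else 0

/-- Conductance of the link between stacks `k - 1` and `k`. -/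
noncomputable def stackG (n : ℕ) (h L : ℝ) (k : ℕ) : ℝ :=
  if k = 0 then 0 else if 2 * n ≤ k then 0 else if k = n then 1 / (2 * L) else 1 / h

set_option maxHeartbeats 1000000 in
theorem stackT_entry (n : ℕ) (hn : 2 ≤ n) (h L : ℝ) (i j : Fin (2 * n)) :
    stackT n h L i j =
      (if j.val = i.val then stackG n h L i.val + stackG n h L (i.val + 1) else 0)
      - (if j.val = i.val - 1 then stackG n h L i.val else 0)
      - (if j.val = i.val + 1 then stackG n h L (i.val + 1) else 0)
      + (if j.val = i.val - 1 then (if i.val = 0 then stackG n h L i.val else 0) else 0) := by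
  obtain ⟨i, hi⟩ := i
  obtain ⟨j, hj⟩ := j
  simp only [stackT, Matrix.of_apply, stackG]
  have e2 : 2 / h = 1 / h + 1 / h := by ring
  rw [e2]
  split_ifs <;> first | (exfalso; omega) | ring

theorem stackT_row (n : ℕ) (hn : 2 ≤ n) (h L : ℝ) (y : ℕ → ℝ) (i : Fin (2 * n)) :
    (stackT n h L).mulVec (fun j => y j.val) i =
      stackG n h L i.val * (y i.val - y (i.val - 1))
      + stackG n h L (i.val + 1) * (y i.val - y (i.val + 1)) := by
  simp only [Matrix.mulVec, dotProduct, stackT_entry n hn]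
  obtain ⟨i, hi⟩ := i
  simp only
  rw [Fin.sum_univ_eq_sum_range (fun j =>
      ((if j = i then stackG n h L i + stackG n h L (i + 1) else 0)
      - (if j = i - 1 then stackG n h L i else 0)
      - (if j = i + 1 then stackG n h L (i + 1) else 0)
      + (if j = i - 1 then (if i = 0 then stackG n h L i else 0) else 0)) * y j) (2 * n)]
  simp only [add_mul, sub_mul, ite_mul, zero_mul, Finset.sum_add_distrib,
    Finset.sum_sub_distrib, Finset.sum_ite_eq', Finset.mem_range]
  have h0 : stackG n h L 0 = 0 := by simp [stackG]
  have h1 : i - 1 < 2 * n := by omega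
  by_cases h2 : i + 1 < 2 * n
  · by_cases h3 : i = 0
    · subst h3; simp [h0, hi, h2]; ring
    · simp [hi, h1, h2, h3]; ring
  · have h4 : stackG n h L (i + 1) = 0 := by
      unfold stackG; rw [if_neg (by omega), if_pos (by omega)]
    have h3 : i ≠ 0 := by omega
    simp [hi, h1, h3, h4]; ring

/-- Kernel of the stack-electrode coupling matrix: `T x = 0` if and only if `x` is a
constant vector; i.e. the kernel of `T` is the one-dimensional span of the all-ones
vector. -/
theorem stackT_kernel (n : ℕ) (hn : 2 ≤ n) (h L : ℝ) (hh : 0 < h) (hL : 0 < L)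
    (x : Fin (2 * n) → ℝ) :
    (stackT n h L).mulVec x = 0 ↔ ∃ c : ℝ, ∀ i, x i = c := by
  constructor
  · intro hx
    obtain ⟨y, rfl⟩ : ∃ y : ℕ → ℝ, x = fun j => y j.val :=
      ⟨fun k => if hk : k < 2 * n then x ⟨k, hk⟩ else 0, by ext j; simp⟩
    have key : ∀ k, k < 2 * n → y k = y 0 := by
      intro k
      induction k with
      | zero => intro _; rfl
      | succ k ih =>
        intro hk
        have aux : ∀ m, m + 1 < 2 * n → y m = y (m + 1) := by
          intro m
          induction m with
          | zero =>
            intro hm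
            have r := congrFun hx ⟨0, by omega⟩
            rw [stackT_row n hn] at r
            have hg : stackG n h L (0 + 1) ≠ 0 := by
              unfold stackG
              rw [if_neg (by omega), if_neg (by omega)]
              split_ifs <;> positivity
            simp only [Nat.zero_sub, sub_self, mul_zero, zero_add, Pi.zero_apply] at r hg ⊢
            rcases mul_eq_zero.mp r with r | r
            · exact absurd r hg
            · linarith
          | succ m im =>
            intro hm
            have r := congrFun hx ⟨m + 1, by omega⟩
            rw [stackT_row n hn] at r
            have hg : stackG n h L (m + 1 + 1) ≠ 0 := by
              unfold stackG
              rw [if_neg (by omega), if_neg (by omega)]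
              split_ifs <;> positivity
            simp only [Nat.add_sub_cancel, im (by omega), sub_self, mul_zero, zero_add,
              Pi.zero_apply] at r
            rcases mul_eq_zero.mp r with r | r
            · exact absurd r hg
            · linarith
        rw [← aux k hk]
        exact ih (by omega)
    exact ⟨y 0, fun i => key i.val i.isLt⟩
  · rintro ⟨c, hc⟩
    obtain rfl : x = fun j => (fun _ : ℕ => c) j.val := funext hc
    ext i
    refine (stackT_row n hn h L (fun _ : ℕ => c) i).trans ?_
    simp
end

section
/- Given an integer n ≥ 2 and positive reals h and L, let T be the matrix described in the context, and let c_1, …, c_{2n} be positive reals with C = diag(c_1, …, c_{2n}). Then the matrix C⁻¹ T has 2n distinct real eigenvalues: there exist reals λ_1 < λ_2 < ⋯ < λ_{2n} with λ_1 = 0 and λ_2 > 0 such that a complex number μ is a root of the characteristic polynomial of C⁻¹ T if and only if μ = λ_i for some i. In other words, C⁻¹ T has one zero eigenvalue and 2n − 1 distinct positive eigenvalues. -/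
open Matrix

theorem stackT_symm (n : ℕ) (h L : ℝ) (i j : Fin (2 * n)) :
    stackT n h L i j = stackT n h L j i := by
  simp only [stackT, Matrix.of_apply]
  by_cases hij : i = j
  · subst hij; rfl
  · have h1 : i.val ≠ j.val := fun e => hij (Fin.ext e)
    rw [if_neg h1, if_neg h1.symm, min_comm]
    simp only [or_comm]

theorem stackT_offdiag (n : ℕ) (h L : ℝ) (hh : 0 < h) (hL : 0 < L) (i j : Fin (2 * n))
    (hij : i ≠ j) : stackT n h L i j ≤ 0 := by
  have h1 : i.val ≠ j.val := fun e => hij (Fin.ext e)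
  have h2 : 0 < 1 / h := by positivity
  have h3 : 0 < 1 / (2 * L) := by positivity
  simp only [stackT, Matrix.of_apply, if_neg h1]
  split_ifs <;> linarith

theorem stackT_rowsum (n : ℕ) (hn : 2 ≤ n) (h L : ℝ) (i : Fin (2 * n)) :
    ∑ j, stackT n h L i j = 0 := by
  obtain ⟨i, hi⟩ := i
  have key : ∀ j : Fin (2 * n), stackT n h L ⟨i, hi⟩ j =
      (if j.val = i then
        (if i = 0 ∨ i = 2 * n - 1 then 1 / h
          else if i = n - 1 ∨ i = n then 1 / h + 1 / (2 * L) else 2 / h) else 0)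
      + (if j.val = i + 1 then (if i = n - 1 then -(1 / (2 * L)) else -(1 / h)) else 0)
      + (if j.val = i - 1 then
          (if i = 0 then 0 else if i = n then -(1 / (2 * L)) else -(1 / h)) else 0) := by
    rintro ⟨j, hj⟩
    simp only [stackT, Matrix.of_apply]
    rcases lt_trichotomy i j with hlt | rfl | hlt
    · rw [if_neg (by omega), min_eq_left hlt.le, if_neg (by omega : ¬ j = i),
        if_neg (by omega : ¬ j = i - 1)]
      by_cases e : j = i + 1
      · simp [e]
      · rw [if_neg (by omega), if_neg e]; simp
    · by_cases e : i = 0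
      · simp [e]
      · rw [if_neg (by omega : ¬ i = i + 1), if_neg (by omega : ¬ i = i - 1)]; simp
    · rw [if_neg (by omega), min_eq_right hlt.le, if_neg (by omega : ¬ j = i),
        if_neg (by omega : ¬ j = i + 1), if_neg (by omega : ¬ i = 0)]
      by_cases e : j = i - 1
      · rw [if_pos (by omega), if_pos e]
        by_cases e' : i = n
        · rw [if_pos (by omega), if_pos e']; simp
        · rw [if_neg (by omega), if_neg e']; simp
      · rw [if_neg (by omega), if_neg e]; simp
  simp only [key]
  have hs : ∀ (k : ℕ) (a : ℝ), ∑ j : Fin (2 * n), (if j.val = k then a else 0) =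
      if k < 2 * n then a else 0 := by
    intro k a
    rw [Fin.sum_univ_eq_sum_range (fun j => if j = k then a else 0) (2 * n)]
    simp
  rw [Finset.sum_add_distrib, Finset.sum_add_distrib, hs, hs, hs]
  rw [if_pos hi, if_pos (by omega : i - 1 < 2 * n)]
  by_cases h0 : i = 0
  · rw [if_pos (Or.inl h0), if_pos (by omega), if_neg (by omega), if_pos h0]; ring
  by_cases h1 : i = 2 * n - 1
  · rw [if_pos (Or.inr h1), if_neg (by omega), if_neg h0, if_neg (by omega)]; ring
  rw [if_neg (by omega), if_pos (by omega : i + 1 < 2 * n), if_neg h0]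
  by_cases h2 : i = n - 1
  · rw [if_pos (Or.inl h2), if_pos h2, if_neg (by omega)]; ring
  by_cases h3 : i = n
  · rw [if_pos (Or.inr h3), if_neg h2, if_pos h3]; ring
  · rw [if_neg (by omega), if_neg h2, if_neg h3]; ring

/-- An eigenvector of a Hessenberg matrix with zero first entry vanishes. -/
theorem hess_zero {m : ℕ} (S : Matrix (Fin m) (Fin m) ℝ)
    (h0 : ∀ i j : Fin m, i.val + 1 < j.val → S i j = 0)
    (h1 : ∀ i j : Fin m, i.val + 1 = j.val → S i j ≠ 0)
    (x : Fin m → ℝ) (μ : ℝ) (hx : S *ᵥ x = μ • x)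
    (hx0 : ∀ i : Fin m, i.val = 0 → x i = 0) : x = 0 := by
  have key : ∀ k : ℕ, ∀ i : Fin m, i.val = k → x i = 0 := by
    intro k
    induction k using Nat.strong_induction_on with
    | _ k ih =>
      intro i hi
      rcases k with _ | k
      · exact hx0 i hi
      · have hr := congrFun hx ⟨k, by omega⟩
        simp only [Matrix.mulVec, dotProduct, Pi.smul_apply, smul_eq_mul] at hr
        rw [ih k (by omega) ⟨k, by omega⟩ rfl, mul_zero, Finset.sum_eq_single i] at hr
        · exact (mul_eq_zero.mp hr).resolve_left (h1 _ _ (by simp [hi]))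
        · intro b _ hb
          have hb' : b.val ≠ i.val := fun e => hb (Fin.ext e)
          rcases lt_or_gt_of_ne hb' with hlt | hgt
          · rw [ih b.val (by omega) b rfl, mul_zero]
          · rw [h0 _ b (by simp only; omega), zero_mul]
        · simp
  funext i
  exact key _ i rfl

/-- Spectrum of `C⁻¹ T` for a positive diagonal matrix `C` and the stack-electrode
coupling matrix `T`: it has `2n` distinct real eigenvalues `λ₁ < λ₂ < ⋯ < λ_{2n}` with
`λ₁ = 0` and `λ₂ > 0`, and a complex number is a root of the characteristic polynomial of
`C⁻¹ T` iff it is one of the `λᵢ`; i.e. `C⁻¹ T` has one zero eigenvalue and `2n − 1`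
distinct positive eigenvalues. -/
theorem stackT_capacitance_spectrum (n : ℕ) (hn : 2 ≤ n) (h L : ℝ)
    (hh : 0 < h) (hL : 0 < L) (c : Fin (2 * n) → ℝ) (hc : ∀ i, 0 < c i) :
    ∃ lam : Fin (2 * n) → ℝ, StrictMono lam ∧
      lam ⟨0, by omega⟩ = 0 ∧ 0 < lam ⟨1, by omega⟩ ∧
      ∀ μ : ℂ,
        (((Matrix.diagonal c)⁻¹ * stackT n h L).charpoly.map (algebraMap ℝ ℂ)).IsRoot μ ↔
          ∃ i : Fin (2 * n), μ = (lam i : ℂ) := by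
  have hm : 0 < 2 * n := by omega
  set T := stackT n h L with hT
  let d : Fin (2 * n) → ℝ := fun i => (Real.sqrt (c i))⁻¹
  have hd : ∀ i, 0 < d i := fun i => inv_pos.mpr (Real.sqrt_pos.mpr (hc i))
  have hdd : ∀ i, d i * d i = (c i)⁻¹ := fun i => by
    simp only [d]; rw [← mul_inv, Real.mul_self_sqrt (hc i).le]
  let S : Matrix (Fin (2 * n)) (Fin (2 * n)) ℝ := diagonal d * T * diagonal d
  have hSij : ∀ i j, S i j = d i * T i j * d j := fun i j => by
    simp [S, Matrix.mul_diagonal, Matrix.diagonal_mul]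
  have hS : S.IsHermitian := by
    ext i j
    simp only [Matrix.conjTranspose_apply, star_trivial, hSij]
    rw [hT, stackT_symm n h L j i]; ring
  have hC : (diagonal c)⁻¹ = diagonal d * diagonal d := by
    apply Matrix.inv_eq_left_inv
    rw [Matrix.diagonal_mul_diagonal, Matrix.diagonal_mul_diagonal, ← Matrix.diagonal_one]
    congr 1
    funext i
    rw [hdd]
    exact inv_mul_cancel₀ (hc i).ne'
  have hchar : ((diagonal c)⁻¹ * T).charpoly = S.charpoly := by
    rw [hC, Matrix.mul_assoc, Matrix.charpoly_mul_comm]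
  have hev : ∀ i, S *ᵥ (hS.eigenvectorBasis i).ofLp =
      hS.eigenvalues i • (hS.eigenvectorBasis i).ofLp := hS.mulVec_eigenvectorBasis
  have hS0 : ∀ i j : Fin (2 * n), i.val + 1 < j.val → S i j = 0 := by
    intro i j hij
    rw [hSij, hT]
    simp only [stackT, Matrix.of_apply]
    rw [if_neg (by omega), if_neg (by omega)]; simp
  have hS1 : ∀ i j : Fin (2 * n), i.val + 1 = j.val → S i j ≠ 0 := by
    intro i j hij
    rw [hSij, hT]
    refine mul_ne_zero (mul_ne_zero (hd i).ne' ?_) (hd j).ne'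
    simp only [stackT, Matrix.of_apply]
    rw [if_neg (by omega), if_pos (Or.inl hij)]
    have h2 : 0 < 1 / h := by positivity
    have h3 : 0 < 1 / (2 * L) := by positivity
    split_ifs <;> linarith
  have hinj : Function.Injective hS.eigenvalues := by
    intro i j hij
    by_contra hne
    set u := hS.eigenvectorBasis i with hu
    set v := hS.eigenvectorBasis j with hv
    let z : Fin (2 * n) := ⟨0, hm⟩
    have hu0 : u.ofLp z ≠ 0 := by
      intro hz
      have := hess_zero S hS0 hS1 u.ofLp _ (hev i) (fun k hk => by
        rw [show k = z from Fin.ext hk]; exact hz)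
      have h' : u = 0 := by ext k; exact congrFun this k
      have := hS.eigenvectorBasis.orthonormal.ne_zero i
      exact this h'
    have hw := hess_zero S hS0 hS1 (v.ofLp z • u.ofLp - u.ofLp z • v.ofLp) (hS.eigenvalues i) (by
      rw [Matrix.mulVec_sub, Matrix.mulVec_smul, Matrix.mulVec_smul, hev i, hev j, ← hij,
        smul_sub, smul_comm, smul_comm (u.ofLp z)]) (fun k hk => by
        rw [show k = z from Fin.ext hk]
        simp [mul_comm])
    have hw' : v.ofLp z • u - u.ofLp z • v = 0 := by ext k; exact congrFun hw k
    have h2 : inner ℝ v (v.ofLp z • u - u.ofLp z • v) = 0 := by rw [hw', inner_zero_right]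
    have hvu : inner ℝ v u = 0 := hS.eigenvectorBasis.orthonormal.2 (Ne.symm hne)
    have hvv : inner ℝ v v = 1 := by
      rw [real_inner_self_eq_norm_sq, hv, hS.eigenvectorBasis.orthonormal.1]; norm_num
    rw [inner_sub_right, inner_smul_right, inner_smul_right, hvu, hvv] at h2
    apply hu0
    linarith
  have hnonneg : ∀ k, 0 ≤ hS.eigenvalues k := by
    intro k
    set u := (hS.eigenvectorBasis k).ofLp with hu
    let y : Fin (2 * n) → ℝ := fun i => d i * u i
    have hTy : ∀ i, ∑ j, T i j * y j = hS.eigenvalues k * (c i * y i) := by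
      intro i
      have := congrFun (hev k) i
      simp only [Matrix.mulVec, dotProduct, Pi.smul_apply, smul_eq_mul, hSij] at this
      have h2 : d i * ∑ j, T i j * y j = hS.eigenvalues k * u i := by
        rw [← this, Finset.mul_sum]
        exact Finset.sum_congr rfl fun j _ => by simp only [y]; ring
      apply mul_left_cancel₀ (hd i).ne'
      rw [h2]
      have h3 : d i * d i * c i = 1 := by rw [hdd]; exact inv_mul_cancel₀ (hc i).ne'
      simp only [y]
      linear_combination (- hS.eigenvalues k * u i) * h3
    have : Nonempty (Fin (2 * n)) := ⟨⟨0, hm⟩⟩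
    obtain ⟨i, hi⟩ := Finite.exists_max (fun i => |y i|)
    have hyi : y i ≠ 0 := by
      intro h0
      have : hS.eigenvectorBasis k = 0 := by
        ext j
        have h1 := hi j
        simp only [h0, abs_zero] at h1
        have h2 : d j * u j = 0 := abs_nonpos_iff.mp h1
        exact (mul_eq_zero.mp h2).resolve_left (hd j).ne'
      exact hS.eigenvectorBasis.orthonormal.ne_zero k this
    have hsum : 0 ≤ ∑ j, T i j * (y j * y i - y i * y i) := by
      apply Finset.sum_nonneg
      intro j _
      by_cases e : i = j
      · subst e; simp
      · refine mul_nonneg_of_nonpos_of_nonpos (stackT_offdiag n h L hh hL i j e) ?_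
        have h1 : y j * y i ≤ |y j| * |y i| := by rw [← abs_mul]; exact le_abs_self _
        have h2 : |y j| * |y i| ≤ |y i| * |y i| :=
          mul_le_mul_of_nonneg_right (hi j) (abs_nonneg _)
        rw [abs_mul_abs_self] at h2
        linarith
    have heq : ∑ j, T i j * (y j * y i - y i * y i) =
        hS.eigenvalues k * (c i * (y i * y i)) := by
      have : ∑ j, T i j * (y j * y i - y i * y i) =
          (∑ j, T i j * y j) * y i - (∑ j, T i j) * (y i * y i) := by
        rw [Finset.sum_mul, Finset.sum_mul, ← Finset.sum_sub_distrib]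
        exact Finset.sum_congr rfl fun j _ => by ring
      rw [this, hTy, hT, stackT_rowsum n hn]; ring
    rw [heq] at hsum
    exact nonneg_of_mul_nonneg_left hsum (mul_pos (hc i) (mul_self_pos.mpr hyi))
  have hzero : ∃ k, hS.eigenvalues k = 0 := by
    have hdT : T.det = 0 := by
      rw [← Matrix.exists_mulVec_eq_zero_iff]
      refine ⟨fun _ => 1, fun e => one_ne_zero (congrFun e ⟨0, hm⟩), ?_⟩
      funext i
      simp only [Matrix.mulVec, dotProduct, mul_one, Pi.zero_apply]
      exact stackT_rowsum n hn h L i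
    have hdS : S.det = 0 := by simp [S, hdT]
    rw [hS.det_eq_prod_eigenvalues] at hdS
    obtain ⟨k, _, hk⟩ := Finset.prod_eq_zero_iff.mp hdS
    exact ⟨k, by simpa using hk⟩
  let F : Finset ℝ := Finset.univ.image hS.eigenvalues
  have hF : F.card = 2 * n := by
    rw [Finset.card_image_of_injective _ hinj]; simp
  have hrange : ∀ x, (∃ i, F.orderEmbOfFin hF i = x) ↔ ∃ k, hS.eigenvalues k = x := by
    intro x
    have := Finset.range_orderEmbOfFin F hF
    have h2 : (∃ i, F.orderEmbOfFin hF i = x) ↔ x ∈ F := Set.ext_iff.mp this x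
    rw [h2]
    simp [F]
  have hz : F.orderEmbOfFin hF ⟨0, by omega⟩ = 0 := by
    apply le_antisymm
    · obtain ⟨i, hi⟩ := (hrange 0).mpr hzero
      rw [← hi]
      exact (F.orderEmbOfFin hF).monotone (Fin.mk_le_of_le_val (Nat.zero_le _))
    · obtain ⟨k, hk⟩ := (hrange _).mp ⟨⟨0, by omega⟩, rfl⟩
      rw [← hk]; exact hnonneg k
  refine ⟨F.orderEmbOfFin hF, (F.orderEmbOfFin hF).strictMono, hz, ?_, ?_⟩
  · rw [← hz]
    apply (F.orderEmbOfFin hF).strictMono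
    simp [Fin.lt_def]
  · intro μ
    rw [hchar, hS.charpoly_eq, Polynomial.IsRoot.def, Polynomial.eval_map, Polynomial.eval₂_finsetProd,
      Finset.prod_eq_zero_iff]
    constructor
    · rintro ⟨k, _, hk⟩
      obtain ⟨i, hi⟩ := (hrange _).mpr ⟨k, rfl⟩
      refine ⟨i, ?_⟩
      rw [hi]
      simpa [sub_eq_zero] using hk
    · rintro ⟨i, hi⟩
      obtain ⟨k, hk⟩ := (hrange _).mp ⟨i, rfl⟩
      refine ⟨k, Finset.mem_univ _, ?_⟩
      simp [hi, hk]
end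

section
/- Let z > 0 and V > 0 be reals and define C(u) = √2 · z^{3/2} · cosh(z u / 2). Suppose ζ : [0, ∞) → ℝ is differentiable with ζ(0) = 0 and satisfies −C(ζ(t)) · ζ'(t) = 2z³ · (V + ζ(t)) for all t ≥ 0. Then for all t > 0: −V < ζ(t) < 0, ζ'(t) < 0 (ζ is strictly decreasing), and ζ(t) → −V as t → +∞. -/
open Real Filter

/-- Uniform bounds on the rate give positivity and decay. -/
lemma charging_deriv_eq (A c w d k : ℝ) (hA : 0 < A) (hc : 0 < c)
    (h : -(A * c) * d = k * w) : d = -(k / (A * c)) * w := by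
  have : A * c ≠ 0 := by positivity
  field_simp
  linarith

/-- Charging dynamics for the two-plate symmetric equivalent circuit ODE
`−C(ζ) ζ' = 2z³ (V + ζ)` with `C(u) = √2 z^{3/2} cosh(zu/2)` and `ζ(0) = 0`:
for all `t > 0` one has `−V < ζ(t) < 0` and `ζ'(t) < 0`, `ζ` is strictly decreasing on
`[0, ∞)`, and `ζ(t) → −V` as `t → +∞`. -/
theorem symmetric_two_plate_charging (z V : ℝ) (hz : 0 < z) (hV : 0 < V)
    (ζ : ℝ → ℝ) (hdiff : ∀ t : ℝ, 0 ≤ t → DifferentiableAt ℝ ζ t) (hζ0 : ζ 0 = 0)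
    (hODE : ∀ t : ℝ, 0 ≤ t →
      -(Real.sqrt 2 * z ^ ((3 : ℝ) / 2) * Real.cosh (z * ζ t / 2)) * deriv ζ t =
        2 * z ^ 3 * (V + ζ t)) :
    (∀ t : ℝ, 0 < t → -V < ζ t ∧ ζ t < 0 ∧ deriv ζ t < 0) ∧
    StrictAntiOn ζ (Set.Ici 0) ∧
    Tendsto ζ atTop (nhds (-V)) := by
  set A : ℝ := Real.sqrt 2 * z ^ ((3 : ℝ) / 2) with hAdef
  have hA : 0 < A := by positivity
  have hd : ∀ t : ℝ, 0 ≤ t →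
      deriv ζ t = -(2 * z ^ 3 / (A * Real.cosh (z * ζ t / 2))) * (V + ζ t) := fun t ht =>
    charging_deriv_eq A _ _ _ _ hA (Real.cosh_pos _) (hODE t ht)
  have hcont : ContinuousOn ζ (Set.Ici 0) := fun t ht =>
    (hdiff t ht).continuousAt.continuousWithinAt
  have hE : ∀ c t : ℝ, HasDerivAt (fun s => Real.exp (c * s)) (Real.exp (c * t) * c) t := by
    intro c t
    simpa using ((hasDerivAt_id t).const_mul c).exp
  have hne : ∀ t : ℝ, 0 ≤ t → V + ζ t ≠ 0 := by
    have hder : ∀ t : ℝ, 0 ≤ t → HasDerivAt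
        (fun s => (V + ζ s) ^ 2 * Real.exp (2 * (2 * z ^ 3 / A) * s))
        (2 * (V + ζ t) * deriv ζ t * Real.exp (2 * (2 * z ^ 3 / A) * t) +
          (V + ζ t) ^ 2 * (Real.exp (2 * (2 * z ^ 3 / A) * t) * (2 * (2 * z ^ 3 / A)))) t := by
      intro t ht
      have h1 := (((hdiff t ht).hasDerivAt.const_add V).pow 2).mul (hE (2 * (2 * z ^ 3 / A)) t)
      refine HasDerivAt.congr_deriv (show HasDerivAt (fun s => (V + ζ s) ^ 2 *
        Real.exp (2 * (2 * z ^ 3 / A) * s)) _ t from h1) ?_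
      simp
    have hmono : MonotoneOn (fun s => (V + ζ s) ^ 2 * Real.exp (2 * (2 * z ^ 3 / A) * s))
        (Set.Ici 0) := by
      apply monotoneOn_of_deriv_nonneg (convex_Ici 0)
      · exact fun t ht => (hder t ht).continuousAt.continuousWithinAt
      · intro t ht
        rw [interior_Ici] at ht
        exact (hder t (le_of_lt ht)).differentiableAt.differentiableWithinAt
      · intro t ht
        rw [interior_Ici] at ht
        have ht' : 0 ≤ t := le_of_lt ht
        rw [(hder t ht').deriv, hd t ht']
        have hk : 2 * z ^ 3 / (A * Real.cosh (z * ζ t / 2)) ≤ 2 * z ^ 3 / A := by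
          apply div_le_div_of_nonneg_left (by positivity) hA
          nlinarith [Real.one_le_cosh (z * ζ t / 2)]
        have : 0 ≤ 2 * (V + ζ t) ^ 2 * Real.exp (2 * (2 * z ^ 3 / A) * t) *
            (2 * z ^ 3 / A - 2 * z ^ 3 / (A * Real.cosh (z * ζ t / 2))) :=
          mul_nonneg (by positivity) (by linarith)
        linarith
    intro t ht h0
    have h := hmono (Set.mem_Ici.2 le_rfl) (Set.mem_Ici.2 ht) ht
    simp only [h0, hζ0] at h
    simp at h
    nlinarith [pow_pos hV 2]
  have hpos : ∀ t : ℝ, 0 ≤ t → 0 < V + ζ t := by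
    intro t ht
    by_contra hcon
    have hsub := intermediate_value_Icc' ht
      ((continuousOn_const (c := V)).add (hcont.mono Set.Icc_subset_Ici_self))
    obtain ⟨s, hs, hs0⟩ := hsub (show (0 : ℝ) ∈ Set.Icc (V + ζ t) (V + ζ 0) from
      ⟨not_lt.1 hcon, by rw [hζ0]; linarith⟩)
    exact hne s hs.1 hs0
  have hneg : ∀ t : ℝ, 0 ≤ t → deriv ζ t < 0 := by
    intro t ht
    rw [hd t ht]
    have h1 := hpos t ht
    have h2 := Real.cosh_pos (z * ζ t / 2)
    have : 0 < 2 * z ^ 3 / (A * Real.cosh (z * ζ t / 2)) * (V + ζ t) := by positivity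
    linarith
  have hanti : StrictAntiOn ζ (Set.Ici 0) := by
    apply strictAntiOn_of_deriv_neg (convex_Ici 0) hcont
    intro t ht
    rw [interior_Ici] at ht
    exact hneg t (le_of_lt ht)
  have hlt : ∀ t : ℝ, 0 < t → ζ t < 0 := by
    intro t ht
    have := hanti (Set.mem_Ici.2 le_rfl) (Set.mem_Ici.2 ht.le) ht
    rwa [hζ0] at this
  refine ⟨fun t ht => ⟨by linarith [hpos t ht.le], hlt t ht, hneg t ht.le⟩, hanti, ?_⟩
  obtain ⟨m, hm⟩ : ∃ m, m = 2 * z ^ 3 / (A * Real.cosh (z * V / 2)) := ⟨_, rfl⟩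
  have hmpos : 0 < m := by
    have h2 := Real.cosh_pos (z * V / 2)
    rw [hm]; positivity
  have hder : ∀ t : ℝ, 0 ≤ t → HasDerivAt (fun s => (V + ζ s) * Real.exp (m * s))
      (deriv ζ t * Real.exp (m * t) + (V + ζ t) * (Real.exp (m * t) * m)) t := fun t ht =>
    ((hdiff t ht).hasDerivAt.const_add V).mul (hE m t)
  have hdec : AntitoneOn (fun s => (V + ζ s) * Real.exp (m * s)) (Set.Ici 0) := by
    apply antitoneOn_of_deriv_nonpos (convex_Ici 0)
    · exact fun t ht => (hder t ht).continuousAt.continuousWithinAt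
    · intro t ht
      rw [interior_Ici] at ht
      exact (hder t (le_of_lt ht)).differentiableAt.differentiableWithinAt
    · intro t ht
      rw [interior_Ici] at ht
      have ht' : 0 ≤ t := le_of_lt ht
      rw [(hder t ht').deriv, hd t ht']
      have hw := hpos t ht'
      have hk : m ≤ 2 * z ^ 3 / (A * Real.cosh (z * ζ t / 2)) := by
        rw [hm]
        have h2 := Real.cosh_pos (z * ζ t / 2)
        apply div_le_div_of_nonneg_left (by positivity) (by positivity)
        apply mul_le_mul_of_nonneg_left _ hA.le
        rw [Real.cosh_le_cosh, abs_of_pos (show 0 < z * V / 2 by positivity), abs_le]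
        have := hlt t ht
        constructor <;> nlinarith
      have : 0 ≤ (V + ζ t) * Real.exp (m * t) *
          (2 * z ^ 3 / (A * Real.cosh (z * ζ t / 2)) - m) :=
        mul_nonneg (by positivity) (by linarith)
      linarith
  have hlim : Tendsto (fun t : ℝ => -V + V * Real.exp (-(m * t))) atTop (nhds (-V)) := by
    have h1 : Tendsto (fun t : ℝ => Real.exp (-(m * t))) atTop (nhds 0) :=
      Real.tendsto_exp_neg_atTop_nhds_zero.comp (tendsto_id.const_mul_atTop hmpos)
    simpa using (h1.const_mul V).const_add (-V)
  refine tendsto_of_tendsto_of_tendsto_of_le_of_le' tendsto_const_nhds hlim ?_ ?_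
  · filter_upwards [eventually_ge_atTop 0] with t ht
    linarith [hpos t ht]
  · filter_upwards [eventually_ge_atTop 0] with t ht
    have h := hdec (Set.mem_Ici.2 le_rfl) (Set.mem_Ici.2 ht) ht
    simp only [hζ0, mul_zero, Real.exp_zero, add_zero, mul_one] at h
    have h3 : V + ζ t ≤ V * Real.exp (-(m * t)) := by
      rw [Real.exp_neg, ← div_eq_mul_inv, le_div_iff₀ (Real.exp_pos _)]
      exact h
    linarith
end

section
/- Let z > 0 and V > 0 be reals and define C(u) = √2 · z^{3/2} · cosh(z u / 2) and α = 2z³. Suppose ζ_L, ζ_R : [0, T) → ℝ are differentiable with ζ_L(0) = ζ_R(0) = 0 and satisfy the system −C(ζ_L(t)) ζ_L'(t) = α·(2V + ζ_L(t) − ζ_R(t))/2 and −C(ζ_R(t)) ζ_R'(t) = α·(−2V + ζ_R(t) − ζ_L(t))/2 for all t ∈ [0, T). Then ζ_R(t) = −ζ_L(t) for all t ∈ [0, T), and consequently ζ_L satisfies the single equation −C(ζ_L(t)) ζ_L'(t) = 2z³·(V + ζ_L(t)). -/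
open Real

/-- Symmetry reduction of the two-plate equivalent circuit system for a symmetric
electrolyte: if `ζ_L, ζ_R` are differentiable on `[0, T)` with `ζ_L(0) = ζ_R(0) = 0` and
satisfy `−C(ζ_L) ζ_L' = α(2V + ζ_L − ζ_R)/2`, `−C(ζ_R) ζ_R' = α(−2V + ζ_R − ζ_L)/2`
with `α = 2z³` and `C(u) = √2 z^{3/2} cosh(zu/2)`, then `ζ_R = −ζ_L` on `[0, T)` and `ζ_L`
satisfies the scalar equation `−C(ζ_L) ζ_L' = 2z³ (V + ζ_L)`. -/
theorem symmetric_two_plate_reduction (z V T : ℝ) (hz : 0 < z) (hV : 0 < V)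
    (ζL ζR : ℝ → ℝ)
    (hdL : ∀ t ∈ Set.Ico (0 : ℝ) T, DifferentiableAt ℝ ζL t)
    (hdR : ∀ t ∈ Set.Ico (0 : ℝ) T, DifferentiableAt ℝ ζR t)
    (h0L : ζL 0 = 0) (h0R : ζR 0 = 0)
    (hODEL : ∀ t ∈ Set.Ico (0 : ℝ) T,
      -(Real.sqrt 2 * z ^ ((3 : ℝ) / 2) * Real.cosh (z * ζL t / 2)) * deriv ζL t =
        2 * z ^ 3 * (2 * V + ζL t - ζR t) / 2)
    (hODER : ∀ t ∈ Set.Ico (0 : ℝ) T,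
      -(Real.sqrt 2 * z ^ ((3 : ℝ) / 2) * Real.cosh (z * ζR t / 2)) * deriv ζR t =
        2 * z ^ 3 * (-(2 * V) + ζR t - ζL t) / 2) :
    ∀ t ∈ Set.Ico (0 : ℝ) T, ζR t = -ζL t ∧
      -(Real.sqrt 2 * z ^ ((3 : ℝ) / 2) * Real.cosh (z * ζL t / 2)) * deriv ζL t =
        2 * z ^ 3 * (V + ζL t) := by
  intro t ht
  have hz3 : 0 < Real.sqrt 2 * z ^ ((3 : ℝ) / 2) := by positivity
  -- the total charge is conserved
  have hder : ∀ s ∈ Set.Ico (0 : ℝ) T, HasDerivAt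
      (fun s => Real.sinh (z * ζL s / 2) + Real.sinh (z * ζR s / 2)) 0 s := by
    intro s hs
    have h1 := ((((hdL s hs).hasDerivAt).const_mul z).div_const 2).sinh
    have h2 := ((((hdR s hs).hasDerivAt).const_mul z).div_const 2).sinh
    refine (h1.add h2).congr_deriv ?_
    have e1 := hODEL s hs
    have e2 := hODER s hs
    have e3 : (Real.sqrt 2 * z ^ ((3 : ℝ) / 2)) *
        (Real.cosh (z * ζL s / 2) * deriv ζL s + Real.cosh (z * ζR s / 2) * deriv ζR s) = 0 := by
      linear_combination -e1 - e2
    have e4 := (mul_eq_zero.mp e3).resolve_left hz3.ne'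
    linear_combination (z / 2) * e4
  have hsub : ∀ s ∈ Set.Icc (0 : ℝ) t, s ∈ Set.Ico (0 : ℝ) T :=
    fun s hs => ⟨hs.1, lt_of_le_of_lt hs.2 ht.2⟩
  have hconst := constant_of_has_deriv_right_zero
    (f := fun s => Real.sinh (z * ζL s / 2) + Real.sinh (z * ζR s / 2)) (a := 0) (b := t)
    (fun s hs => (hder s (hsub s hs)).continuousAt.continuousWithinAt)
    (fun s hs => (hder s (hsub s ⟨hs.1, hs.2.le⟩)).hasDerivWithinAt) t ⟨ht.1, le_rfl⟩
  have hR : ζR t = -ζL t := by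
    simp only [h0L, h0R, mul_zero, zero_div, Real.sinh_zero, add_zero] at hconst
    have h : Real.sinh (z * ζR t / 2) = Real.sinh (-(z * ζL t / 2)) := by
      rw [Real.sinh_neg]; linarith
    have h' := Real.sinh_injective h
    have h'' : z * ζR t = z * (-ζL t) := by linarith
    exact mul_left_cancel₀ hz.ne' h''
  refine ⟨hR, ?_⟩
  rw [hODEL t ht, hR]
  ring
end
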